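/- For all real numbers x, k, t with x ≥ k ≥ 1 and 0 ≤ t ≤ 1, we have (1+x)^t ≥ 1 + ((1+k)^t - 1)/k^t · x^t. -/

import Mathlib

theorem stmt_1 (x k t : ℝ) (hxk : x ≥ k) (hk : k ≥ 1) (ht0 : 0 ≤ t) (ht1 : t ≤ 1) :
    (1 + x) ^ t ≥ 1 + ((1 + k) ^ t - 1) / k ^ t * x ^ t := by
  have hk0 : 0 < k := by linarith
  obtain ⟨c, hc⟩ : ∃ c, c = x / k := ⟨_, rfl⟩
  have hx : x = c * k := by rw [hc]; field_simp
  have hc1 : 1 ≤ c := by rw [hc, le_div_iff₀ hk0]; linarith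
  have hd : 0 < c + x - 1 := by linarith
  have hconc := (Real.concaveOn_rpow ht0 ht1).2
  obtain ⟨s, hs⟩ : ∃ s, s = (c - 1) / (c + x - 1) := ⟨_, rfl⟩
  have hs0 : 0 ≤ s := by rw [hs]; apply div_nonneg <;> linarith
  have hs1 : s ≤ 1 := by rw [hs, div_le_one hd]; linarith
  have hsd : s * (c + x - 1) = c - 1 := by rw [hs]; field_simp
  have m1 : (1 : ℝ) ∈ Set.Ici (0 : ℝ) := by simp
  have m2 : c + x ∈ Set.Ici (0 : ℝ) := by simp only [Set.mem_Ici]; linarith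
  have h1 := hconc m1 m2 (sub_nonneg.2 hs1) hs0 (by ring)
  have h2 := hconc m1 m2 hs0 (sub_nonneg.2 hs1) (by ring)
  simp only [smul_eq_mul, Real.one_rpow] at h1 h2
  rw [show (1 - s) * 1 + s * (c + x) = c by linarith] at h1
  rw [show s * 1 + (1 - s) * (c + x) = 1 + x by linarith] at h2
  have e1 : (c + x) ^ t = c ^ t * (1 + k) ^ t := by
    rw [← Real.mul_rpow (by linarith) (by linarith), hx]; congr 1; ring
  have e2 : x ^ t = c ^ t * k ^ t := by
    rw [← Real.mul_rpow (by linarith) (by linarith), hx]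
  have hkt : 0 < k ^ t := Real.rpow_pos_of_pos hk0 t
  have e3 : ((1 + k) ^ t - 1) / k ^ t * x ^ t = (c + x) ^ t - c ^ t := by
    rw [e1, e2]; field_simp
  rw [e3]
  linarith
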